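/- Let w = w_t be the work function at time t ≥ 1 of a 3-server instance on the circle of circumference 2Δ with last request r = r_t, let u be a circle point, and let (x,y,z) ∈ P. If w({u,y,z̄}) resolves from y and w({u,z,x̄}) resolves from x̄, then Φ*(w, u, x, y, z) ≥ Φ*(w, r, u, z, ū); moreover the triple (u, z, ū) belongs to P. -/

import Mathlib

open Finset

/-- Minimum-matching (Wasserstein) distance between two `k`-point configurations,
represented as `k`-tuples of points. -/
noncomputable def confDist {Ω : Type*} [MetricSpace Ω] {k : ℕ} (X Y : Fin k → Ω) : ℝ :=
  ⨅ σ : Equiv.Perm (Fin k), ∑ i, dist (X i) (Y (σ i))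

/-- The work function at time `t` of the `k`-server instance with initial configuration
`X₀` and requests `r 1, r 2, …` (the value `r 0` is unused): the least cost of serving
the first `t` requests and then moving to the configuration `X`. -/
noncomputable def workFn {Ω : Type*} [MetricSpace Ω] (k : ℕ) (X₀ : Fin k → Ω)
    (r : ℕ → Ω) (t : ℕ) (X : Fin k → Ω) : ℝ :=
  sInf { c : ℝ | ∃ Y : ℕ → Fin k → Ω, Y 0 = X₀ ∧
    (∀ i ∈ Finset.Icc 1 t, ∃ j, Y i j = r i) ∧
    c = (∑ i ∈ Finset.Icc 1 t, confDist (Y (i - 1)) (Y i)) + confDist (Y t) X }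

/-- The offline optimum of the `k`-server instance with initial configuration `X₀`
and requests `r 1, …, r T`. -/
noncomputable def opt {Ω : Type*} [MetricSpace Ω] (k : ℕ) (X₀ : Fin k → Ω)
    (r : ℕ → Ω) (T : ℕ) : ℝ :=
  sInf { c : ℝ | ∃ Y : ℕ → Fin k → Ω, Y 0 = X₀ ∧
    (∀ i ∈ Finset.Icc 1 T, ∃ j, Y i j = r i) ∧
    c = ∑ i ∈ Finset.Icc 1 T, confDist (Y (i - 1)) (Y i) }

/-- `OPT_t(Z)`: the least cost of serving the first `t` requests while ending
in the configuration `Z`. -/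
noncomputable def optTo {Ω : Type*} [MetricSpace Ω] (k : ℕ) (X₀ : Fin k → Ω)
    (r : ℕ → Ω) (t : ℕ) (Z : Fin k → Ω) : ℝ :=
  sInf { c : ℝ | ∃ Y : ℕ → Fin k → Ω, Y 0 = X₀ ∧
    (∀ i ∈ Finset.Icc 1 t, ∃ j, Y i j = r i) ∧ Y t = Z ∧
    c = ∑ i ∈ Finset.Icc 1 t, confDist (Y (i - 1)) (Y i) }

/-- `X 0, X 1, …, X T` is a run of the work function algorithm on the `k`-server
instance with initial configuration `X₀` and requests `r 1, …, r T`. -/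
def IsWFARun {Ω : Type*} [MetricSpace Ω] (k : ℕ) (X₀ : Fin k → Ω)
    (r : ℕ → Ω) (T : ℕ) (X : ℕ → Fin k → Ω) : Prop :=
  X 0 = X₀ ∧ ∀ t, 1 ≤ t → t ≤ T →
    (∃ j, X t j = r t) ∧
    ∀ Z : Fin k → Ω, (∃ j, Z j = r t) →
      optTo k X₀ r t (X t) + confDist (X t) (X (t - 1)) ≤
        optTo k X₀ r t Z + confDist Z (X (t - 1))
/-- The antipode `x̄ = x + Δ` of a point on the circle of circumference `2Δ`. -/
noncomputable def antip (Δ : ℝ) (x : AddCircle (2*Δ)) : AddCircle (2*Δ) := x + (Δ : ℝ)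

/-- The set `P`: triples of circle points not contained in any open semicircle,
i.e. with `d(x,y) + d(y,z) + d(z,x) = 2Δ`. -/
def InP (Δ : ℝ) (x y z : AddCircle (2*Δ)) : Prop :=
  dist x y + dist y z + dist z x = 2*Δ

/-- The potential `Φ*(w,u,x,y,z) = w(ū³) + w(u x ȳ) + w(u y z̄) + w(u z x̄)`. -/
noncomputable def PhiStar (Δ : ℝ) (w : (Fin 3 → AddCircle (2*Δ)) → ℝ)
    (u x y z : AddCircle (2*Δ)) : ℝ :=
  w ![antip Δ u, antip Δ u, antip Δ u] + w ![u, x, antip Δ y]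
    + w ![u, y, antip Δ z] + w ![u, z, antip Δ x]

/-- `w(X)` resolves from the `i`-th point of the configuration `X` (w.r.t. the
last request `r`): `w(X) = w(X - X i + r) + d(X i, r)`. -/
def ResolvesFrom {Ω : Type*} [MetricSpace Ω] (w : (Fin 3 → Ω) → ℝ) (r : Ω)
    (X : Fin 3 → Ω) (i : Fin 3) : Prop :=
  w X = w (Function.update X i r) + dist (X i) r

section WorkFunction

variable {Ω : Type*} [MetricSpace Ω] {k : ℕ}

theorem confDist_le_sum (X Y : Fin k → Ω) (σ : Equiv.Perm (Fin k)) :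
    confDist X Y ≤ ∑ i, dist (X i) (Y (σ i)) :=
  ciInf_le (Set.finite_range _).bddBelow σ

theorem exists_confDist_eq_sum (X Y : Fin k → Ω) :
    ∃ σ : Equiv.Perm (Fin k), confDist X Y = ∑ i, dist (X i) (Y (σ i)) := by
  obtain ⟨σ, hσ⟩ := exists_eq_ciInf_of_finite
    (f := fun σ : Equiv.Perm (Fin k) => ∑ i, dist (X i) (Y (σ i)))
  exact ⟨σ, hσ.symm⟩

theorem confDist_nonneg (X Y : Fin k → Ω) : 0 ≤ confDist X Y :=
  Real.iInf_nonneg fun _ => sum_nonneg fun _ _ => dist_nonneg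

theorem confDist_const (X : Fin k → Ω) (a : Ω) :
    confDist X (fun _ => a) = ∑ i, dist (X i) a := by
  simp [confDist]

theorem confDist_le_confDist_add_sum (X Y Z : Fin k → Ω) (σ : Equiv.Perm (Fin k)) :
    confDist X Z ≤ confDist X Y + ∑ i, dist (Y i) (Z (σ i)) := by
  obtain ⟨τ, hτ⟩ := exists_confDist_eq_sum X Y
  calc confDist X Z ≤ ∑ i, dist (X i) (Z (σ (τ i))) := confDist_le_sum X Z (τ.trans σ)
    _ ≤ ∑ i, (dist (X i) (Y (τ i)) + dist (Y (τ i)) (Z (σ (τ i)))) :=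
      sum_le_sum fun _ _ => dist_triangle _ _ _
    _ = confDist X Y + ∑ i, dist (Y i) (Z (σ i)) := by
      rw [sum_add_distrib, hτ, Equiv.sum_comp τ fun i => dist (Y i) (Z (σ i))]

/-- Replacing one copy of `a` in the constant configuration `a, …, a` by a point of `X`
saves exactly the cost of moving that point to `a`. -/
theorem confDist_update_const_add_dist_le (X : Fin k → Ω) (a : Ω) (i j : Fin k) :
    confDist X (Function.update (fun _ => a) i (X j)) + dist (X j) a ≤
      confDist X (fun _ => a) := by
  refine (add_le_add_left (confDist_le_sum X _ (Equiv.swap j i)) _).trans ?_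
  rw [confDist_const, ← add_sum_erase _ _ (mem_univ j),
    ← add_sum_erase _ (fun l => dist (X l) a) (mem_univ j)]
  have h : ∑ l ∈ univ.erase j, dist (X l)
      (Function.update (fun _ => a) i (X j) (Equiv.swap j i l)) =
      ∑ l ∈ univ.erase j, dist (X l) a := by
    refine sum_congr rfl fun l hl => ?_
    rw [Function.update_of_ne]
    rw [Ne, Equiv.swap_apply_eq_iff, Equiv.swap_apply_right]
    exact ne_of_mem_erase hl
  rw [h, Equiv.swap_apply_left, Function.update_self, dist_self, zero_add, add_comm]

variable (X₀ : Fin k → Ω) (r : ℕ → Ω) (t : ℕ)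

theorem workFn_le (Y : ℕ → Fin k → Ω) (h0 : Y 0 = X₀)
    (hY : ∀ i ∈ Icc 1 t, ∃ j, Y i j = r i) (X : Fin k → Ω) :
    workFn k X₀ r t X ≤
      (∑ i ∈ Icc 1 t, confDist (Y (i - 1)) (Y i)) + confDist (Y t) X := by
  refine csInf_le ⟨0, ?_⟩ ⟨Y, h0, hY, rfl⟩
  rintro _ ⟨Y', -, -, rfl⟩
  exact add_nonneg (sum_nonneg fun _ _ => confDist_nonneg _ _) (confDist_nonneg _ _)

theorem le_workFn [NeZero k] {X : Fin k → Ω} {a : ℝ}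
    (h : ∀ Y : ℕ → Fin k → Ω, Y 0 = X₀ → (∀ i ∈ Icc 1 t, ∃ j, Y i j = r i) →
      a ≤ (∑ i ∈ Icc 1 t, confDist (Y (i - 1)) (Y i)) + confDist (Y t) X) :
    a ≤ workFn k X₀ r t X := by
  refine le_csInf ⟨_, fun i => if i = 0 then X₀ else fun _ => r i, if_pos rfl, ?_, rfl⟩ ?_
  · intro i hi
    refine ⟨0, ?_⟩
    simp [Nat.one_le_iff_ne_zero.mp (mem_Icc.mp hi).1]
  · rintro _ ⟨Y, h0, hY, rfl⟩
    exact h Y h0 hY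

theorem workFn_le_workFn_add_sum [NeZero k] (X Y : Fin k → Ω) (σ : Equiv.Perm (Fin k)) :
    workFn k X₀ r t Y ≤ workFn k X₀ r t X + ∑ i, dist (X i) (Y (σ i)) := by
  rw [← sub_le_iff_le_add]
  refine le_workFn X₀ r t fun Z h0 hZ => ?_
  have h1 := workFn_le X₀ r t Z h0 hZ Y
  have h2 := confDist_le_confDist_add_sum (Z t) X Y σ
  linarith

/-- A work function resolves from every point of a constant configuration. -/
theorem workFn_update_const_add_dist_le [NeZero k] (ht : 1 ≤ t) (a : Ω) (i : Fin k) :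
    workFn k X₀ r t (Function.update (fun _ => a) i (r t)) + dist (r t) a ≤
      workFn k X₀ r t fun _ => a := by
  refine le_workFn X₀ r t fun Z h0 hZ => ?_
  obtain ⟨j, hj⟩ := hZ t (mem_Icc.mpr ⟨ht, le_rfl⟩)
  have h1 := workFn_le X₀ r t Z h0 hZ (Function.update (fun _ => a) i (r t))
  have h2 := confDist_update_const_add_dist_le (Z t) a i j
  rw [hj] at h2
  linarith

end WorkFunction

section Antipode

variable {Δ : ℝ}

theorem antip_antip (x : AddCircle (2*Δ)) : antip Δ (antip Δ x) = x := by
  rw [antip, antip, add_assoc, ← AddCircle.coe_add, ← two_mul, AddCircle.coe_period, add_zero]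

theorem dist_antip_antip (x y : AddCircle (2*Δ)) :
    dist (antip Δ x) (antip Δ y) = dist x y :=
  dist_add_right x y _

theorem dist_antip_left (x y : AddCircle (2*Δ)) : dist (antip Δ x) y = dist x (antip Δ y) := by
  rw [← dist_antip_antip, antip_antip]

theorem dist_add_dist_antip (hΔ : 0 < Δ) (x y : AddCircle (2*Δ)) :
    dist x y + dist y (antip Δ x) = Δ := by
  have norm_coe {v : ℝ} (hv : |v| ≤ Δ) : ‖(v : AddCircle (2*Δ))‖ = |v| := by
    have h2 : 0 < 2 * Δ := by positivity
    rw [AddCircle.norm_coe_eq_abs_iff _ h2.ne', abs_of_pos h2]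
    linarith
  have : Fact (0 < 2 * Δ) := ⟨by positivity⟩
  obtain ⟨v, ⟨hv0, hv1⟩, hv⟩ : ∃ v ∈ Set.Ico (-Δ) (-Δ + 2 * Δ), (v : AddCircle (2*Δ)) = y - x :=
    ⟨_, (AddCircle.equivIco (2*Δ) (-Δ) (y - x)).2, AddCircle.coe_equivIco⟩
  have hy : y - antip Δ x = ((v - Δ : ℝ) : AddCircle (2*Δ)) := by
    rw [AddCircle.coe_sub, hv, antip]; abel
  rw [dist_comm x y, dist_eq_norm, dist_eq_norm, hy, ← hv,
    norm_coe (abs_le.mpr ⟨hv0, by linarith⟩)]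
  rcases le_total 0 v with h | h
  · rw [norm_coe (abs_le.mpr ⟨by linarith, by linarith⟩), abs_of_nonneg h,
      abs_of_nonpos (by linarith)]
    ring
  · have hs : ((v - Δ : ℝ) : AddCircle (2*Δ)) = ((v + Δ : ℝ) : AddCircle (2*Δ)) := by
      rw [← AddCircle.coe_add_period (2*Δ) (v - Δ)]
      congr 1
      ring
    rw [hs, norm_coe (abs_le.mpr ⟨by linarith, by linarith⟩), abs_of_nonpos h,
      abs_of_nonneg (by linarith)]
    ring

theorem inP_antip (hΔ : 0 < Δ) (u z : AddCircle (2*Δ)) : InP Δ u z (antip Δ u) := by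
  have h := dist_add_dist_antip hΔ u u
  rw [dist_self, zero_add, dist_comm] at h
  rw [InP, dist_add_dist_antip hΔ, h, two_mul]

end Antipode

/-- Subcase 1a: if `w(u y z̄)` resolves from `y` and `w(u z x̄)` resolves from `x̄`, then
`Φ*(w,u,x,y,z) ≥ Φ*(w,r,u,z,ū)`, and `(u,z,ū) ∈ P`. -/
theorem phiStar_subcase_1a (Δ : ℝ) (hΔ : 0 < Δ)
    (X₀ : Fin 3 → AddCircle (2*Δ)) (r : ℕ → AddCircle (2*Δ)) (T t : ℕ)
    (ht : 1 ≤ t) (htT : t ≤ T) (u x y z : AddCircle (2*Δ)) (hP : InP Δ x y z)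
    (h2 : ResolvesFrom (workFn 3 X₀ r t) (r t) ![u, y, antip Δ z] 1)
    (h3 : ResolvesFrom (workFn 3 X₀ r t) (r t) ![u, z, antip Δ x] 2) :
    PhiStar Δ (workFn 3 X₀ r t) (r t) u z (antip Δ u) ≤
        PhiStar Δ (workFn 3 X₀ r t) u x y z ∧
      InP Δ u z (antip Δ u) := by
  refine ⟨?_, inP_antip hΔ u z⟩
  have upd1 (a b c d : AddCircle (2*Δ)) : Function.update ![a, b, c] 1 d = ![a, d, c] := by
    ext i; fin_cases i <;> rfl
  have upd2 (a b c d : AddCircle (2*Δ)) : Function.update ![a, b, c] 2 d = ![a, b, d] := by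
    ext i; fin_cases i <;> rfl
  have const_eq : (fun _ => antip Δ u) = ![antip Δ u, antip Δ u, antip Δ u] := by
    ext i; fin_cases i <;> rfl
  rw [ResolvesFrom, upd1] at h2
  rw [ResolvesFrom, upd2] at h3
  have hres := workFn_update_const_add_dist_le X₀ r t ht (antip Δ u) 2
  rw [const_eq, upd2] at hres
  have lip := workFn_le_workFn_add_sum X₀ r t
  have lip_x := lip ![u, x, antip Δ y] ![antip Δ (r t), antip Δ (r t), antip Δ (r t)] 1
  have perm1 := lip ![u, r t, antip Δ z] ![r t, u, antip Δ z] (Equiv.swap 0 1)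
  have perm2 := lip ![u, z, r t] ![r t, z, u] (Equiv.swap 0 2)
  have perm3 := lip ![antip Δ u, antip Δ u, r t] ![r t, antip Δ u, antip Δ u] (Equiv.swap 0 2)
  have swap1 : Equiv.swap (0 : Fin 3) 1 2 = 2 := by decide
  have swap2 : Equiv.swap (0 : Fin 3) 2 1 = 1 := by decide
  simp only [Fin.sum_univ_three, Equiv.Perm.one_apply, Equiv.swap_apply_left,
    Equiv.swap_apply_right, swap1, swap2, Matrix.cons_val, dist_self, dist_antip_antip,
    add_zero] at h2 h3 lip_x perm1 perm2 perm3
  rw [← dist_antip_left, dist_comm _ (r t), ← dist_antip_left x] at lip_x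
  simp only [PhiStar, antip_antip]
  linarith
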